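/- arXiv:1304.7626 — 5 statements merged into one kernel-verified Lean document; each statement's English description precedes it below -/
import Mathlib

section
/- Fix β ∈ (0,1) and λ with 0 < λ < m(β). Then the equation j(z,β) = λ (in z > 0) has exactly two roots z1 < z2; moreover z1 ∈ (0,1) and z2 ∈ (1/β, ∞), j(z,β) < λ for z ∈ [0, z1), j(z,β) > λ for z ∈ (z1, z2), and j(z,β) < λ for z ∈ (z2, ∞). -/
open Real Filter Topology

/-- j1(z,β) = (βz/2)·e^{−βz} -/
noncomputable def j1 (z β : ℝ) : ℝ := β * z / 2 * Real.exp (-(β * z))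
/-- j2(z) = (z/2)·e^{−z} -/
noncomputable def j2 (z : ℝ) : ℝ := z / 2 * Real.exp (-z)
/-- j(z,β) = j1(z,β) + j2(z) -/
noncomputable def j (z β : ℝ) : ℝ := j1 z β + j2 z
/-- m(β) = min_{1 ≤ z ≤ 1/β} j(z,β) -/
noncomputable def m (β : ℝ) : ℝ := sInf ((fun z => j z β) '' Set.Icc 1 (1 / β))

noncomputable def gaux (x : ℝ) : ℝ := x / 2 * Real.exp (-x)

lemma gaux_deriv (x : ℝ) : HasDerivAt gaux ((1 - x) / 2 * Real.exp (-x)) x := by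
  have h1 : HasDerivAt (fun x : ℝ => x / 2) (1 / 2) x := (hasDerivAt_id x).div_const 2
  have h2 : HasDerivAt (fun x : ℝ => Real.exp (-x)) (Real.exp (-x) * (-1)) x :=
    (hasDerivAt_neg x).exp
  have h := h1.mul h2
  refine (h.congr_deriv ?_)
  ring

lemma gaux_cont : Continuous gaux := by
  unfold gaux
  fun_prop

lemma gaux_mono : StrictMonoOn gaux (Set.Icc 0 1) := by
  apply strictMonoOn_of_deriv_pos (convex_Icc 0 1) gaux_cont.continuousOn
  intro x hx
  rw [interior_Icc] at hx
  rw [(gaux_deriv x).deriv]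
  have := Real.exp_pos (-x)
  have h : 0 < 1 - x := by linarith [hx.2]
  positivity

lemma gaux_anti : StrictAntiOn gaux (Set.Ici 1) := by
  apply strictAntiOn_of_deriv_neg (convex_Ici 1) gaux_cont.continuousOn
  intro x hx
  rw [interior_Ici] at hx
  rw [(gaux_deriv x).deriv]
  have := Real.exp_pos (-x)
  have h : (1 - x) / 2 < 0 := by linarith [Set.mem_Ioi.1 hx]
  exact mul_neg_of_neg_of_pos h this

lemma gaux_tendsto : Tendsto gaux atTop (𝓝 0) := by
  have h := (Real.tendsto_pow_mul_exp_neg_atTop_nhds_zero 1).div_const 2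
  rw [zero_div] at h
  refine h.congr ?_
  intro x
  simp only [gaux, pow_one]
  ring

lemma j_gaux (z β : ℝ) : j z β = gaux (β * z) + gaux z := rfl

/-- For β ∈ (0,1) and 0 < λ < m(β), the equation j(z,β) = λ (z > 0) has exactly two
roots z1 < z2, with z1 ∈ (0,1), z2 ∈ (1/β,∞), j < λ on [0,z1), j > λ on (z1,z2),
and j < λ on (z2,∞). -/
theorem stmt3 (β lam : ℝ) (hβ : β ∈ Set.Ioo (0:ℝ) 1)
    (hlam : 0 < lam) (hlam' : lam < m β) :
    ∃ z1 z2 : ℝ, 0 < z1 ∧ z1 < 1 ∧ 1 / β < z2 ∧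
      j z1 β = lam ∧ j z2 β = lam ∧
      (∀ z, 0 < z → j z β = lam → z = z1 ∨ z = z2) ∧
      (∀ z, 0 ≤ z → z < z1 → j z β < lam) ∧
      (∀ z, z1 < z → z < z2 → lam < j z β) ∧
      (∀ z, z2 < z → j z β < lam) := by
  obtain ⟨hb0, hb1⟩ := hβ
  have hinv : 1 < 1 / β := by rw [lt_div_iff₀ hb0]; linarith
  have hbi : β * (1 / β) = 1 := by field_simp
  have hcont : Continuous (fun z => j z β) := by
    unfold j j1 j2
    fun_prop
  have hmono : StrictMonoOn (fun z => j z β) (Set.Icc 0 1) := by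
    intro x hx y hy hxy
    have h1 := gaux_mono hx hy hxy
    have h2 : gaux (β * x) < gaux (β * y) := by
      apply gaux_mono
      · exact ⟨mul_nonneg hb0.le hx.1, by nlinarith [hx.1, hx.2]⟩
      · exact ⟨mul_nonneg hb0.le hy.1, by nlinarith [hy.1, hy.2]⟩
      · exact mul_lt_mul_of_pos_left hxy hb0
    simp only [j_gaux]
    linarith
  have hone : ∀ z, 1 / β ≤ z → 1 ≤ β * z := by
    intro z hz
    rw [← hbi]
    exact mul_le_mul_of_nonneg_left hz hb0.le
  have hanti : StrictAntiOn (fun z => j z β) (Set.Ici (1 / β)) := by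
    intro x hx y hy hxy
    have hx' : 1 / β ≤ x := hx
    have hy' : 1 / β ≤ y := hy
    have h1 : gaux y < gaux x :=
      gaux_anti (Set.mem_Ici.2 (by linarith)) (Set.mem_Ici.2 (by linarith)) hxy
    have h2 : gaux (β * y) < gaux (β * x) :=
      gaux_anti (Set.mem_Ici.2 (hone x hx')) (Set.mem_Ici.2 (hone y hy'))
        (mul_lt_mul_of_pos_left hxy hb0)
    simp only [j_gaux]
    linarith
  have hmid : ∀ z, 1 ≤ z → z ≤ 1 / β → lam < j z β := by
    intro z h1 h2
    refine lt_of_lt_of_le hlam' ?_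
    exact csInf_le (isCompact_Icc.image hcont).bddBelow ⟨z, ⟨h1, h2⟩, rfl⟩
  have hj0 : j 0 β = 0 := by simp [j, j1, j2]
  have hlim : Tendsto (fun z => j z β) atTop (𝓝 0) := by
    have h := (gaux_tendsto.comp (tendsto_id.const_mul_atTop hb0)).add gaux_tendsto
    rw [add_zero] at h
    exact h
  have hl1 := hmid 1 le_rfl hinv.le
  have hl2 := hmid (1 / β) hinv.le le_rfl
  obtain ⟨z1, hz1, e1⟩ := intermediate_value_Ioo (zero_le_one' ℝ) hcont.continuousOn
    (show lam ∈ Set.Ioo (j 0 β) (j 1 β) from ⟨by rw [hj0]; exact hlam, hl1⟩)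
  obtain ⟨B, hB1, hB2⟩ :=
    ((hlim.eventually_lt_const hlam).and (eventually_ge_atTop (1 / β))).exists
  obtain ⟨z2, hz2, e2⟩ := intermediate_value_Ioo' hB2 hcont.continuousOn
    (show lam ∈ Set.Ioo (j B β) (j (1 / β) β) from ⟨hB1, hl2⟩)
  have e1' : j z1 β = lam := e1
  have e2' : j z2 β = lam := e2
  have A : ∀ z, 0 ≤ z → z < z1 → j z β < lam := by
    intro z h0 h
    rw [← e1']
    exact hmono ⟨h0, by linarith [hz1.2]⟩ ⟨hz1.1.le, hz1.2.le⟩ h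
  have B' : ∀ z, z1 < z → z < z2 → lam < j z β := by
    intro z h h'
    rcases le_or_gt z 1 with h1 | h1
    · rw [← e1']
      exact hmono ⟨hz1.1.le, hz1.2.le⟩ ⟨by linarith [hz1.1], h1⟩ h
    · rcases le_or_gt z (1 / β) with h2 | h2
      · exact hmid z h1.le h2
      · rw [← e2']
        exact hanti (Set.mem_Ici.2 h2.le) (Set.mem_Ici.2 hz2.1.le) h'
  have C : ∀ z, z2 < z → j z β < lam := by
    intro z h
    rw [← e2']
    exact hanti (Set.mem_Ici.2 hz2.1.le) (Set.mem_Ici.2 (hz2.1.le.trans h.le)) h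
  refine ⟨z1, z2, hz1.1, hz1.2, hz2.1, e1', e2', ?_, A, B', C⟩
  intro z h0 hz
  rcases lt_trichotomy z z1 with h | h | h
  · exact absurd hz (A z h0.le h).ne
  · exact Or.inl h
  · rcases lt_trichotomy z z2 with h' | h' | h'
    · exact absurd hz (B' z h h').ne'
    · exact Or.inr h'
    · exact absurd hz (C z h').ne
end

section
/- Let 0 < λ1 < e^{−1}. There exists β1 ∈ (0,1) such that for all β ∈ [β1, 1) and all λ ∈ (0, λ1], one has β·z2(β,λ) > 1, where z2(β,λ) is the larger root of the equation j(z,β) = λ. Consequently, for such β and λ, j1(z1,β) − j2(z1) < 0 < j1(z2,β) − j2(z2), where z1 = z1(β,λ) and z2 = z2(β,λ) are the two roots of j(z,β) = λ. -/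
open Real Filter Topology

lemma aux_hasDeriv (x : ℝ) :
    HasDerivAt (fun x : ℝ => x * Real.exp (-x)) ((1 - x) * Real.exp (-x)) x := by
  have h := (hasDerivAt_id x).mul ((hasDerivAt_id x).neg.exp)
  refine h.congr_deriv ?_
  simp only [id, Pi.neg_apply]
  ring

lemma aux_mono : StrictMonoOn (fun x : ℝ => x * Real.exp (-x)) (Set.Iic 1) := by
  apply strictMonoOn_of_deriv_pos (convex_Iic 1) (by fun_prop)
  intro x hx
  rw [interior_Iic, Set.mem_Iio] at hx
  rw [(aux_hasDeriv x).deriv]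
  exact mul_pos (by linarith) (Real.exp_pos _)

lemma aux_anti : StrictAntiOn (fun x : ℝ => x * Real.exp (-x)) (Set.Ici 1) := by
  apply strictAntiOn_of_deriv_neg (convex_Ici 1) (by fun_prop)
  intro x hx
  rw [interior_Ici, Set.mem_Ioi] at hx
  rw [(aux_hasDeriv x).deriv]
  exact mul_neg_of_neg_of_pos (by linarith) (Real.exp_pos _)

/-- For 0 < λ1 < e^{−1}, there is β1 ∈ (0,1) such that for all β ∈ [β1,1) and all
λ ∈ (0,λ1], if z1 < z2 are the two roots of j(z,β) = λ, then β·z2 > 1 and hence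
j1(z1,β) − j2(z1) < 0 < j1(z2,β) − j2(z2). -/
theorem stmt6 (lam1 : ℝ) (h0 : 0 < lam1) (h1 : lam1 < Real.exp (-1)) :
    ∃ β1 ∈ Set.Ioo (0:ℝ) 1, ∀ β : ℝ, β1 ≤ β → β < 1 →
      ∀ lam : ℝ, 0 < lam → lam ≤ lam1 →
      ∀ z1 z2 : ℝ, 0 < z1 → z1 < z2 →
        j z1 β = lam → j z2 β = lam →
        (∀ z, 0 < z → j z β = lam → z = z1 ∨ z = z2) →
        1 < β * z2 ∧ j1 z1 β - j2 z1 < 0 ∧ 0 < j1 z2 β - j2 z2 := by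
  have hc : ContinuousAt (fun β : ℝ => (β * Real.exp (-β) + β⁻¹ * Real.exp (-β⁻¹)) / 2) 1 := by
    have hi : ContinuousAt (fun β : ℝ => β⁻¹) 1 := continuousAt_inv₀ one_ne_zero
    fun_prop (disch := norm_num)
  have hev : ∀ᶠ β in 𝓝 (1:ℝ), lam1 < (β * Real.exp (-β) + β⁻¹ * Real.exp (-β⁻¹)) / 2 := by
    apply hc.eventually_const_lt
    norm_num
    exact h1
  obtain ⟨ε, hε, hb⟩ := Metric.eventually_nhds_iff.1 hev
  have hm1 : 1/2 ≤ max (1/2) (1 - ε/2) := le_max_left _ _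
  have hm2 : 1 - ε/2 ≤ max (1/2) (1 - ε/2) := le_max_right _ _
  refine ⟨max (1/2) (1 - ε/2), ⟨by linarith, max_lt (by norm_num) (by linarith)⟩, ?_⟩
  intro β hβ1 hβ lam _ hlam z1 z2 hz1 hz hj1 hj2 _
  have hβ0 : 0 < β := by linarith
  have hlow := hb (y := β) (by rw [Real.dist_eq, abs_lt]; constructor <;> linarith)
  have mono : ∀ x y : ℝ, x < y → y ≤ 1 → x * Real.exp (-x) < y * Real.exp (-y) :=
    fun x y h hy => aux_mono (Set.mem_Iic.2 (h.le.trans hy)) (Set.mem_Iic.2 hy) h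
  have anti : ∀ x y : ℝ, x < y → 1 ≤ x → y * Real.exp (-y) < x * Real.exp (-x) :=
    fun x y h hx => aux_anti (Set.mem_Ici.2 hx) (Set.mem_Ici.2 (hx.trans h.le)) h
  have hmid : ∀ z, 1 ≤ z → β * z ≤ 1 → j z β ≠ lam := by
    intro z h h' he
    have a1 : β * Real.exp (-β) ≤ (β * z) * Real.exp (-(β * z)) :=
      aux_mono.monotoneOn (Set.mem_Iic.2 hβ.le) (Set.mem_Iic.2 h') (by nlinarith)
    have hzi : z ≤ β⁻¹ := by
      rw [← one_div, le_div_iff₀ hβ0]; linarith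
    have a2 : β⁻¹ * Real.exp (-β⁻¹) ≤ z * Real.exp (-z) :=
      aux_anti.antitoneOn (Set.mem_Ici.2 h) (Set.mem_Ici.2 (h.trans hzi)) hzi
    unfold j j1 j2 at he
    linarith
  have hloc : ∀ z, 0 < z → j z β = lam → z < 1 ∨ 1 < β * z := by
    intro z _ he
    by_contra! hcon
    exact hmid z hcon.1 hcon.2 he
  have hbz : β * z1 < β * z2 := mul_lt_mul_of_pos_left hz hβ0
  have hz2 : 1 < β * z2 := by
    rcases hloc z2 (hz1.trans hz) hj2 with h | h
    · exfalso
      have a1 := mono z1 z2 hz h.le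
      have a2 := mono (β * z1) (β * z2) hbz (by nlinarith)
      unfold j j1 j2 at hj1 hj2
      linarith
    · exact h
  have hz1' : z1 < 1 := by
    rcases hloc z1 hz1 hj1 with h | h
    · exact h
    · exfalso
      have a1 := anti z1 z2 hz (by nlinarith)
      have a2 := anti (β * z1) (β * z2) hbz h.le
      unfold j j1 j2 at hj1 hj2
      linarith
  refine ⟨hz2, ?_, ?_⟩
  · have := mono (β * z1) z1 (by nlinarith) hz1'.le
    unfold j1 j2
    linarith
  · have := anti (β * z2) z2 (by nlinarith) hz2.le
    unfold j1 j2
    linarith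
end

section
/- Fix β ∈ (0,1), λ ∈ (0,1), and D > 0, and let z1 < z2 be the two roots of j(z,β) = λ. Suppose b1(z1,β,D) < 0 and b1(z2,β,D) > 0. Then the equation b1(z,β,D) = 0 (in z > 0) has exactly two roots t1 < t2, and they satisfy 0 < t1 < z1 < t2 < z2. -/
open Real Filter Topology

/-- b1(z,β,D) = 1 − j(z,β) + D·(j1(z,β) − j2(z)) -/
noncomputable def b1 (z β D : ℝ) : ℝ := 1 - j z β + D * (j1 z β - j2 z)

lemma aux_convex (k γ : ℝ) (hk : 0 < k) (hγ : 0 < γ) :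
    StrictConvexOn ℝ (Set.Ioi (0:ℝ))
      (fun z => Real.exp (z - Real.log z) + k * Real.exp (γ * z)) := by
  refine ⟨convex_Ioi 0, ?_⟩
  intro x hx y hy hxy p q hp hq hpq
  have hlog := strictConcaveOn_log_Ioi.2 hx hy hxy hp hq hpq
  have he := convexOn_exp.2 (Set.mem_univ (x - Real.log x)) (Set.mem_univ (y - Real.log y))
    hp.le hq.le hpq
  have he2 := convexOn_exp.2 (Set.mem_univ (γ * x)) (Set.mem_univ (γ * y))
    hp.le hq.le hpq
  simp only [smul_eq_mul] at *
  have h1 : Real.exp (p * x + q * y - Real.log (p * x + q * y))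
      < Real.exp (p * (x - Real.log x) + q * (y - Real.log y)) := by
    apply Real.exp_lt_exp.2
    nlinarith
  have h2 : γ * (p * x + q * y) = p * (γ * x) + q * (γ * y) := by ring
  rw [h2]
  have h3 := mul_le_mul_of_nonneg_left he2 hk.le
  nlinarith

lemma aux_eq (β D z : ℝ) (hz : 0 < z) (h : b1 z β D = 0) :
    Real.exp (z - Real.log z) + ((D - 1) * β / 2) * Real.exp ((1 - β) * z) = (D + 1) / 2 := by
  have h1 : Real.exp ((1 - β) * z) = Real.exp z * Real.exp (-(β * z)) := by
    rw [← Real.exp_add]; ring_nf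
  have h2 : Real.exp z * Real.exp (-z) = 1 := by
    rw [← Real.exp_add]; simp
  rw [Real.exp_sub, Real.exp_log hz, h1]
  unfold b1 j j1 j2 at h
  generalize Real.exp (-(β * z)) = E at *
  field_simp
  linear_combination (2 * Real.exp z) * h + (D + 1) * z * h2

lemma aux_three (β D x y w : ℝ) (hβ : 0 < β) (hβ1 : β < 1) (hD : 1 < D) (hx : 0 < x)
    (hxy : x < y) (hyw : y < w) (h1 : b1 x β D = 0) (h2 : b1 y β D = 0)
    (h3 : b1 w β D = 0) : False := by
  have e1 := aux_eq β D x hx h1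
  have e2 := aux_eq β D y (hx.trans hxy) h2
  have e3 := aux_eq β D w (hx.trans (hxy.trans hyw)) h3
  have hc := aux_convex ((D - 1) * β / 2) (1 - β)
    (by have := mul_pos (sub_pos.2 hD) hβ; linarith) (by linarith)
  have hs := hc.slope_strict_mono_adjacent (x := x) (y := y) (z := w) hx
    (hx.trans (hxy.trans hyw)) hxy hyw
  simp only [e1, e2, e3, sub_self, zero_div, lt_irrefl] at hs

lemma aux_half (x : ℝ) : x / 2 * Real.exp (-x) < 1 / 2 := by
  have h1 := Real.add_one_le_exp x
  have h2 : Real.exp x * Real.exp (-x) = 1 := by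
    rw [← Real.exp_add]; simp
  have h3 := Real.exp_pos (-x)
  nlinarith

/-- If z1 < z2 are the two roots of j(z,β) = λ and b1(z1,β,D) < 0 < b1(z2,β,D),
then b1(·,β,D) = 0 has exactly two roots t1 < t2 in (0,∞), satisfying
0 < t1 < z1 < t2 < z2. -/
theorem stmt8 (β lam D z1 z2 : ℝ)
    (hβ : β ∈ Set.Ioo (0:ℝ) 1) (hlam : lam ∈ Set.Ioo (0:ℝ) 1) (hD : 0 < D)
    (hz1 : 0 < z1) (hz12 : z1 < z2)
    (hroot1 : j z1 β = lam) (hroot2 : j z2 β = lam)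
    (honly : ∀ z, 0 < z → j z β = lam → z = z1 ∨ z = z2)
    (hb1 : b1 z1 β D < 0) (hb2 : 0 < b1 z2 β D) :
    ∃ t1 t2 : ℝ, 0 < t1 ∧ t1 < z1 ∧ z1 < t2 ∧ t2 < z2 ∧
      b1 t1 β D = 0 ∧ b1 t2 β D = 0 ∧
      (∀ t, 0 < t → b1 t β D = 0 → t = t1 ∨ t = t2) := by
  obtain ⟨hβ0, hβ1⟩ := hβ
  have hD1 : 1 < D := by
    by_contra hcon
    push Not at hcon
    have ha := aux_half (β * z1)
    have hb := aux_half z1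
    unfold b1 j j1 j2 at hb1
    nlinarith
  have hcont : Continuous (fun z => b1 z β D) := by
    unfold b1 j j1 j2
    fun_prop
  have h0 : b1 0 β D = 1 := by simp [b1, j, j1, j2]
  obtain ⟨t1, ⟨ht1, ht1'⟩, e1⟩ := intermediate_value_Ioo' hz1.le hcont.continuousOn
    (show (0:ℝ) ∈ Set.Ioo (b1 z1 β D) (b1 0 β D) from ⟨hb1, by rw [h0]; norm_num⟩)
  obtain ⟨t2, ⟨ht2, ht2'⟩, e2⟩ := intermediate_value_Ioo hz12.le hcont.continuousOn
    (show (0:ℝ) ∈ Set.Ioo (b1 z1 β D) (b1 z2 β D) from ⟨hb1, hb2⟩)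
  refine ⟨t1, t2, ht1, ht1', ht2, ht2', e1, e2, ?_⟩
  intro t ht e
  rcases lt_trichotomy t t1 with h | h | h
  · exact (aux_three β D t t1 t2 hβ0 hβ1 hD1 ht h (ht1'.trans ht2) e e1 e2).elim
  · exact Or.inl h
  · rcases lt_trichotomy t t2 with h' | h' | h'
    · exact (aux_three β D t1 t t2 hβ0 hβ1 hD1 ht1 h h' e1 e e2).elim
    · exact Or.inr h'
    · exact (aux_three β D t1 t2 t hβ0 hβ1 hD1 ht1 (ht1'.trans ht2) h' e1 e2 e).elim
end

section
/- Let 0 < λ ≤ λ1 < e^{−1}, β ∈ (0,1), D ≥ 0, and C ≥ (λ1 + 1)/(1 − e^{−1}). Then for every z ≥ 1 with βz ≥ 1, one has r(z,β) ≤ −1. -/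
open Real Filter Topology

/-- a(z,β) = λ − j(z,β) -/
noncomputable def a (z β lam : ℝ) : ℝ := lam - j z β
/-- b(z,β) = C(1 − j(z,β)) + CD(j1(z,β) − j2(z)) -/
noncomputable def b (z β C D : ℝ) : ℝ := C * (1 - j z β) + C * D * (j1 z β - j2 z)
/-- r(z,β) = a(z,β) − z·b(z,β) -/
noncomputable def r (z β lam C D : ℝ) : ℝ := a z β lam - z * b z β C D

/-- For 0 < λ ≤ λ1 < e^{−1}, β ∈ (0,1), D ≥ 0 and C ≥ (λ1+1)/(1−e^{−1}),
one has r(z,β) ≤ −1 for every z ≥ 1 with βz ≥ 1. -/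
theorem stmt9 (β lam lam1 C D : ℝ)
    (hβ : β ∈ Set.Ioo (0:ℝ) 1)
    (h0 : 0 < lam) (hle : lam ≤ lam1) (h1 : lam1 < Real.exp (-1))
    (hD : 0 ≤ D) (hC : (lam1 + 1) / (1 - Real.exp (-1)) ≤ C) :
    ∀ z : ℝ, 1 ≤ z → 1 ≤ β * z → r z β lam C D ≤ -1 := by
  intro z hz hx
  obtain ⟨hb0, hb1⟩ := hβ
  have key : ∀ x : ℝ, x * Real.exp (-x) ≤ Real.exp (-1) := by
    intro x
    have h := Real.add_one_le_exp (x - 1)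
    have e : Real.exp (-1) = Real.exp (x - 1) * Real.exp (-x) := by
      rw [← Real.exp_add]; congr 1; ring
    rw [e]
    exact mul_le_mul_of_nonneg_right (by linarith) (Real.exp_pos _).le
  have hxz : β * z ≤ z := by nlinarith
  have hmono : z * Real.exp (-z) ≤ β * z * Real.exp (-(β * z)) := by
    have h := Real.add_one_le_exp (z - β * z)
    have e : Real.exp (-(β * z)) = Real.exp (z - β * z) * Real.exp (-z) := by
      rw [← Real.exp_add]; congr 1; ring
    rw [e, ← mul_assoc]
    refine mul_le_mul_of_nonneg_right ?_ (Real.exp_pos _).le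
    have h2 := mul_le_mul_of_nonneg_left h (by linarith : 0 ≤ β * z)
    have h3 := mul_nonneg (sub_nonneg.2 hx) (sub_nonneg.2 hxz)
    linarith
  have hE : Real.exp (-1) < 1 := by
    rw [Real.exp_lt_one_iff]; norm_num
  rw [div_le_iff₀ (by linarith)] at hC
  have hC0 : 0 ≤ C := by
    by_contra hn
    have := mul_neg_of_neg_of_pos (not_le.1 hn) (sub_pos.2 hE)
    linarith
  have hj : j z β ≤ Real.exp (-1) := by
    have h2 := key (β * z)
    have h3 := key z
    unfold j j1 j2
    linarith
  have hj0 : 0 ≤ j z β := by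
    have h2 := mul_nonneg (by linarith : 0 ≤ β * z) (Real.exp_pos (-(β * z))).le
    have h3 := mul_nonneg (by linarith : 0 ≤ z) (Real.exp_pos (-z)).le
    unfold j j1 j2
    linarith
  have hd : 0 ≤ j1 z β - j2 z := by
    unfold j1 j2
    linarith
  have hb : lam1 + 1 ≤ b z β C D := by
    have h2 := mul_le_mul_of_nonneg_left hj hC0
    have h3 := mul_nonneg (mul_nonneg hC0 hD) hd
    unfold b
    linarith
  have hzb : b z β C D ≤ z * b z β C D :=
    le_mul_of_one_le_left (by linarith) hz
  unfold r a
  linarith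
end

section
/- Let 0 < λ0 < λ1 < e^{−1}. There exists β1 ∈ (0,1) such that for every λ ∈ (λ0, λ1), every β ∈ (β1, 1), every C ≥ (λ1 + 1)/(1 − e^{−1}), and every D ≥ D(C) (for a suitable threshold D(C) depending on C, β, λ0, λ1), the following hold: (i) the equation a(z,β) = 0 has exactly two roots 0 < z1 < z2 < ∞; (ii) the equation b(z,β) = 0 has exactly two roots 0 < t1 < t2 < ∞; (iii) 0 < t1 < z1 < t2 < z2; (iv) r(z,β) > 0 for z ∈ (0, z1) and r(z,β) < 0 for z > t2, so that all roots of r(z,β) = 0 lie in the interval (z1, t2). -/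
open Real Filter Topology

lemma aux_mono_s13 {x y : ℝ} (hx : 0 ≤ x) (hxy : x < y) (hy : y ≤ 1) :
    x / 2 * Real.exp (-x) < y / 2 * Real.exp (-y) := by
  have h1 : x - y + 1 < Real.exp (x - y) := Real.add_one_lt_exp (by linarith)
  have h2 : Real.exp (-y) = Real.exp (-x) * Real.exp (x - y) := by
    rw [← Real.exp_add]; ring_nf
  have h3 := Real.exp_pos (-x)
  have hy0 : 0 < y := by linarith
  have h4 : x < y * Real.exp (x - y) := by
    nlinarith [mul_lt_mul_of_pos_left h1 hy0, mul_nonneg (sub_nonneg.2 hxy.le) (sub_nonneg.2 hy)]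
  rw [h2]
  nlinarith [mul_lt_mul_of_pos_left h4 h3]

lemma aux_anti_s13 {x y : ℝ} (hx : 1 ≤ x) (hxy : x < y) :
    y / 2 * Real.exp (-y) < x / 2 * Real.exp (-x) := by
  have h1 : y - x + 1 < Real.exp (y - x) := Real.add_one_lt_exp (by linarith)
  have h2 : Real.exp (-x) = Real.exp (-y) * Real.exp (y - x) := by
    rw [← Real.exp_add]; ring_nf
  have h3 := Real.exp_pos (-y)
  have hx0 : 0 < x := by linarith
  have h4 : y < x * Real.exp (y - x) := by
    nlinarith [mul_lt_mul_of_pos_left h1 hx0, mul_nonneg (sub_nonneg.2 hxy.le) (sub_nonneg.2 hx)]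
  rw [h2]
  nlinarith [mul_lt_mul_of_pos_left h4 h3]

lemma aux_le {x : ℝ} (hx : 0 ≤ x) : x / 2 * Real.exp (-x) ≤ Real.exp (-1) / 2 := by
  rcases lt_trichotomy x 1 with h | h | h
  · have := aux_mono_s13 hx h le_rfl; linarith
  · subst h; linarith
  · have := aux_anti_s13 le_rfl h; linarith

/-- rescaled `-b` -/
noncomputable def KK (β D z : ℝ) : ℝ :=
  (D + 1) * (z * Real.exp (-((1 - β) * z))) - (D - 1) * β * z - 2 * Real.exp (β * z)

lemma b_eq (z β C D : ℝ) : b z β C D = -(C / 2 * Real.exp (-(β * z)) * KK β D z) := by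
  have h1 : Real.exp (-z) = Real.exp (-(β * z)) * Real.exp (-((1 - β) * z)) := by
    rw [← Real.exp_add]; ring_nf
  have h2 : Real.exp (-(β * z)) * Real.exp (β * z) = 1 := by
    rw [← Real.exp_add]; simp
  unfold b j j1 j2 KK
  rw [h1]
  linear_combination (-C) * h2

lemma KK_cont (β D : ℝ) : Continuous (KK β D) := by
  unfold KK; fun_prop

lemma KK_concave {β D : ℝ} (hβ : 1 / 2 < β) (hβ1 : β < 1) (hD : 0 < D) :
    StrictConcaveOn ℝ (Set.Icc 0 2) (KK β D) := by
  have hd : ∀ z, HasDerivAt (KK β D) ((D + 1) * ((1 - (1 - β) * z) * Real.exp (-((1 - β) * z)))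
      - (D - 1) * β - 2 * β * Real.exp (β * z)) z := by
    intro z
    have e1 : HasDerivAt (fun z : ℝ => Real.exp (-((1 - β) * z)))
        (Real.exp (-((1 - β) * z)) * (-((1 - β) * 1))) z :=
      (((hasDerivAt_id z).const_mul (1 - β)).neg).exp
    have e2 : HasDerivAt (fun z : ℝ => Real.exp (β * z)) (Real.exp (β * z) * (β * 1)) z :=
      ((hasDerivAt_id z).const_mul β).exp
    have e3 := ((((hasDerivAt_id z).mul e1).const_mul (D + 1)).sub
      ((hasDerivAt_id z).const_mul ((D - 1) * β))).sub (e2.const_mul 2)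
    refine e3.congr_deriv ?_
    simp only [id]; ring
  have hd2 : ∀ z, HasDerivAt (deriv (KK β D))
      (-((D + 1) * (1 - β) * (2 - (1 - β) * z) * Real.exp (-((1 - β) * z)))
        - 2 * β ^ 2 * Real.exp (β * z)) z := by
    intro z
    rw [show deriv (KK β D) = fun z => (D + 1) * ((1 - (1 - β) * z) * Real.exp (-((1 - β) * z)))
      - (D - 1) * β - 2 * β * Real.exp (β * z) from funext fun z => (hd z).deriv]
    have e1 : HasDerivAt (fun z : ℝ => Real.exp (-((1 - β) * z)))
        (Real.exp (-((1 - β) * z)) * (-((1 - β) * 1))) z :=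
      (((hasDerivAt_id z).const_mul (1 - β)).neg).exp
    have e2 : HasDerivAt (fun z : ℝ => Real.exp (β * z)) (Real.exp (β * z) * (β * 1)) z :=
      ((hasDerivAt_id z).const_mul β).exp
    have e0 : HasDerivAt (fun z : ℝ => 1 - (1 - β) * z) (-((1 - β) * 1)) z :=
      ((hasDerivAt_id z).const_mul (1 - β)).const_sub 1
    have e3 := (((e0.mul e1).const_mul (D + 1)).sub_const ((D - 1) * β)).sub (e2.const_mul (2 * β))
    refine e3.congr_deriv ?_
    ring
  refine strictConcaveOn_of_deriv2_neg (convex_Icc 0 2) (KK_cont β D).continuousOn ?_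
  intro z hz
  rw [interior_Icc] at hz
  have : deriv^[2] (KK β D) z = deriv (deriv (KK β D)) z := rfl
  rw [this, (hd2 z).deriv]
  have h1 : 0 < 2 - (1 - β) * z := by nlinarith [hz.1, hz.2]
  have h2 : 0 < 1 - β := by linarith
  have : 0 < (D + 1) * (1 - β) * (2 - (1 - β) * z) * Real.exp (-((1 - β) * z)) := by positivity
  have : 0 < 2 * β ^ 2 * Real.exp (β * z) := by positivity
  linarith

lemma conc_pos {K : ℝ → ℝ} (h : StrictConcaveOn ℝ (Set.Icc 0 2) K) {s t z : ℝ}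
    (hs : 0 ≤ s) (ht : t ≤ 2) (hKs : K s = 0) (hKt : K t = 0) (h1 : s < z) (h2 : z < t) :
    0 < K z := by
  have := h.slope_anti_adjacent (x := s) (y := z) (z := t) ⟨hs, by linarith⟩ ⟨by linarith, ht⟩ h1 h2
  rw [hKs, hKt] at this
  by_contra hc
  push Not at hc
  have a1 : 0 ≤ (0 - K z) / (t - z) := div_nonneg (by linarith) (by linarith)
  have a2 : (K z - 0) / (z - s) ≤ 0 := div_nonpos_of_nonpos_of_nonneg (by linarith) (by linarith)
  linarith

lemma conc_neg_left {K : ℝ → ℝ} (h : StrictConcaveOn ℝ (Set.Icc 0 2) K) {s t z : ℝ}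
    (ht : t ≤ 2) (hKs : K s = 0) (hKt : K t = 0) (h0 : 0 ≤ z) (h1 : z < s) (h2 : s < t) :
    K z < 0 := by
  have := h.slope_anti_adjacent (x := z) (y := s) (z := t) ⟨h0, by linarith⟩ ⟨by linarith, ht⟩ h1 h2
  rw [hKs, hKt] at this
  by_contra hc
  push Not at hc
  have a2 : (0 - K z) / (s - z) ≤ 0 := div_nonpos_of_nonpos_of_nonneg (by linarith) (by linarith)
  simp at this a2
  linarith

lemma conc_neg_right {K : ℝ → ℝ} (h : StrictConcaveOn ℝ (Set.Icc 0 2) K) {s t z : ℝ}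
    (hs : 0 ≤ s) (hKs : K s = 0) (hKt : K t = 0) (h0 : z ≤ 2) (h1 : s < t) (h2 : t < z) :
    K z < 0 := by
  have := h.slope_anti_adjacent (x := s) (y := t) (z := z) ⟨hs, by linarith⟩ ⟨by linarith, h0⟩ h1 h2
  rw [hKs, hKt] at this
  by_contra hc
  push Not at hc
  have a2 : 0 ≤ (K z - 0) / (z - t) := div_nonneg (by linarith) (by linarith)
  simp at this a2
  linarith

lemma aux_D {A : ℝ} (B : ℝ) (hA : 0 < A) : ∃ D0 : ℝ, 0 < D0 ∧ ∀ D, D0 ≤ D → 0 < D * A + B := by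
  refine ⟨(|B| + 1) / A, by positivity, fun D hD => ?_⟩
  rw [div_le_iff₀ hA] at hD
  linarith [neg_abs_le B]

lemma KK_large {β p : ℝ} (hβ1 : β < 1) (hβ : 0 < β) (hp : 0 < p) (hp1 : p ≤ 1) :
    ∃ D0 : ℝ, 0 < D0 ∧ ∀ D, D0 ≤ D → 0 < KK β D p := by
  have h1 : β < Real.exp (-((1 - β) * p)) := by
    have := Real.add_one_lt_exp (x := β - 1) (by linarith)
    have h2 : Real.exp (β - 1) ≤ Real.exp (-((1 - β) * p)) := Real.exp_le_exp.2 (by nlinarith)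
    linarith
  obtain ⟨D0, hD0, h⟩ := aux_D (p * Real.exp (-((1 - β) * p)) + β * p - 2 * Real.exp (β * p))
    (mul_pos hp (sub_pos.2 h1))
  refine ⟨D0, hD0, fun D hD => ?_⟩
  have := h D hD
  unfold KK
  linarith

lemma j_cont (β : ℝ) : Continuous (fun z => j z β) := by
  unfold j j1 j2; fun_prop

lemma j_mono {β x y : ℝ} (hβ : 0 < β) (hβ1 : β < 1) (hx : 0 ≤ x) (hxy : x < y) (hy : y ≤ 1) :
    j x β < j y β := by
  have h1 := aux_mono_s13 hx hxy hy
  have h2 := aux_mono_s13 (x := β * x) (y := β * y) (by positivity) (by nlinarith) (by nlinarith)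
  unfold j j1 j2
  linarith

lemma j_anti {β x y : ℝ} (hβ : 0 < β) (hβ1 : β < 1) (hx : 1 / β ≤ x) (hxy : x < y) :
    j y β < j x β := by
  have hx' : 1 ≤ β * x := by rw [div_le_iff₀ hβ] at hx; linarith
  have h1 := aux_anti_s13 (x := x) (y := y) (by nlinarith) hxy
  have h2 := aux_anti_s13 (x := β * x) (y := β * y) hx' (by nlinarith)
  unfold j j1 j2
  linarith

lemma j_mid {β z : ℝ} (hβ : 0 < β) (hz : 1 ≤ z) (hz' : z ≤ 1 / β) :
    Real.exp (-1) * (2 - 1 / β) ≤ j z β := by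
  have hx' : β * z ≤ 1 := by rw [le_div_iff₀ hβ] at hz'; linarith
  have h0 := Real.exp_pos (-1)
  have hbb : 2 - 1 / β ≤ β := by
    have : β + 1 / β - 2 = (β - 1) ^ 2 / β := by field_simp; ring
    have : 0 ≤ (β - 1) ^ 2 / β := by positivity
    linarith
  have e1 : Real.exp (-1) ≤ Real.exp (-(β * z)) := Real.exp_le_exp.2 (by linarith)
  have e2 : Real.exp (-1) * (2 - z) ≤ Real.exp (-z) := by
    have h1 := Real.add_one_le_exp (1 - z)
    have h2 : Real.exp (-z) = Real.exp (-1) * Real.exp (1 - z) := by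
      rw [← Real.exp_add]; ring_nf
    rw [h2]
    exact mul_le_mul_of_nonneg_left (by linarith) h0.le
  have hbz : β ≤ β * z := by nlinarith
  have h3 : Real.exp (-1) * (2 - 1 / β) ≤ β * z * Real.exp (-(β * z)) := by
    have : β * Real.exp (-1) ≤ β * z * Real.exp (-(β * z)) := by gcongr
    nlinarith
  have h4 : Real.exp (-1) * (2 - 1 / β) ≤ z * Real.exp (-z) := by
    have : Real.exp (-1) * (2 - 1 / β) ≤ Real.exp (-1) * (2 - z) :=
      mul_le_mul_of_nonneg_left (by linarith) h0.le
    nlinarith [Real.exp_pos (-z)]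
  unfold j j1 j2
  linarith

lemma j_le {β z : ℝ} (hβ : 0 < β) (hβ1 : β < 1) (hz : 0 < z) : j z β < z := by
  have e1 : Real.exp (-(β * z)) ≤ 1 := Real.exp_le_one_iff.2 (by nlinarith)
  have e2 : Real.exp (-z) ≤ 1 := Real.exp_le_one_iff.2 (by linarith)
  unfold j j1 j2
  have h1 : β * z / 2 * Real.exp (-(β * z)) ≤ β * z / 2 * 1 :=
    mul_le_mul_of_nonneg_left e1 (by positivity)
  have h2 : z / 2 * Real.exp (-z) ≤ z / 2 * 1 := mul_le_mul_of_nonneg_left e2 (by positivity)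
  nlinarith

lemma j_le' {β z : ℝ} (hβ : 0 < β) (hz : 0 ≤ z) : j z β ≤ Real.exp (-1) := by
  have h1 := aux_le hz
  have h2 := aux_le (x := β * z) (by positivity)
  unfold j j1 j2
  linarith

lemma j_nonneg {β z : ℝ} (hβ : 0 < β) (hz : 0 ≤ z) : 0 ≤ j z β := by
  unfold j j1 j2; positivity

lemma j12_right {β z : ℝ} (hβ : 0 < β) (hβ1 : β < 1) (hz : 1 / β ≤ z) : j2 z < j1 z β := by
  have hx' : 1 ≤ β * z := by rw [div_le_iff₀ hβ] at hz; linarith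
  exact aux_anti_s13 hx' (by nlinarith)

lemma j12_left {β z : ℝ} (hβ : 0 < β) (hβ1 : β < 1) (hz : 0 < z) (hz1 : z ≤ 1) :
    j1 z β < j2 z :=
  aux_mono_s13 (by positivity) (by nlinarith) hz1

lemma j_tendsto {β : ℝ} (hβ : 0 < β) : Tendsto (fun z => j z β) atTop (𝓝 0) := by
  have h := Real.tendsto_pow_mul_exp_neg_atTop_nhds_zero 1
  have h1 : Tendsto (fun x : ℝ => x / 2 * Real.exp (-x)) atTop (𝓝 0) := by
    have := h.const_mul (1 / 2)
    rw [mul_zero] at this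
    refine this.congr fun x => ?_
    ring
  have h2 := h1.comp (tendsto_id.const_mul_atTop hβ)
  have := h2.add h1
  rw [add_zero] at this
  exact this

set_option maxHeartbeats 1000000 in
/-- Lemma 1: for 0 < λ0 < λ1 < e^{−1} there is β1 ∈ (0,1) such that for every
β ∈ (β1,1), every C ≥ (λ1+1)/(1−e^{−1}) and every D large enough (D ≥ D(C)),
and every λ ∈ (λ0,λ1): a(·,β) = 0 has exactly two roots 0 < z1 < z2,
b(·,β) = 0 has exactly two roots 0 < t1 < t2, they interlace as
0 < t1 < z1 < t2 < z2, and r > 0 on (0,z1), r < 0 on (t2,∞), so all roots of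
r(z,β) = 0 lie in (z1,t2). -/
theorem stmt13 (lam0 lam1 : ℝ) (h0 : 0 < lam0) (h01 : lam0 < lam1)
    (h1 : lam1 < Real.exp (-1)) :
    ∃ β1 ∈ Set.Ioo (0:ℝ) 1, ∀ β ∈ Set.Ioo β1 1,
      ∀ C : ℝ, (lam1 + 1) / (1 - Real.exp (-1)) ≤ C →
      ∃ D0 : ℝ, 0 < D0 ∧ ∀ D : ℝ, D0 ≤ D →
      ∀ lam ∈ Set.Ioo lam0 lam1,
      ∃ z1 z2 t1 t2 : ℝ,
        0 < t1 ∧ t1 < z1 ∧ z1 < t2 ∧ t2 < z2 ∧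
        a z1 β lam = 0 ∧ a z2 β lam = 0 ∧
        (∀ z, 0 < z → a z β lam = 0 → z = z1 ∨ z = z2) ∧
        b t1 β C D = 0 ∧ b t2 β C D = 0 ∧
        (∀ z, 0 < z → b z β C D = 0 → z = t1 ∨ z = t2) ∧
        (∀ z, 0 < z → z < z1 → 0 < r z β lam C D) ∧
        (∀ z, t2 < z → r z β lam C D < 0) := by
  have he : 0 < Real.exp (-1) := Real.exp_pos _
  have he1 : Real.exp (-1) < 1 := by rw [Real.exp_lt_one_iff]; norm_num
  set q := lam1 / Real.exp (-1) with hq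
  have hq0 : 0 < q := div_pos (by linarith) he
  have hq1 : q < 1 := by rw [hq, div_lt_one he]; exact h1
  have hqe : q * Real.exp (-1) = lam1 := by rw [hq]; field_simp
  refine ⟨1 / (2 - q), ⟨by apply div_pos <;> linarith, ?_⟩, ?_⟩
  · rw [div_lt_one (by linarith)]; linarith
  rintro β ⟨hβl, hβ1⟩ C hC
  have hβh : 1 / 2 < β := by
    have : (1:ℝ) / 2 < 1 / (2 - q) := one_div_lt_one_div_of_lt (by linarith) (by linarith)
    linarith
  have hβ : 0 < β := by linarith
  have hib : 1 / β < 2 - q := by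
    rw [div_lt_iff₀ (by linarith)] at hβl
    rw [div_lt_iff₀ hβ]; linarith
  have hib1 : 1 < 1 / β := by rw [lt_div_iff₀ hβ]; linarith
  have hmid : ∀ z, 1 ≤ z → z ≤ 1 / β → lam1 < j z β := by
    intro z hz hz'
    have := j_mid hβ hz hz'
    nlinarith
  have hCe : lam1 + 1 ≤ C * (1 - Real.exp (-1)) := by
    rwa [div_le_iff₀ (by linarith)] at hC
  have hC0 : 0 < C := lt_of_lt_of_le (by apply div_pos <;> linarith) hC
  set p := lam0 / (1 + C) with hp
  have hp0 : 0 < p := by positivity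
  have hpC : p * (1 + C) = lam0 := by rw [hp]; field_simp
  have hpl : p < lam0 := by nlinarith
  have hp1 : p < 1 := by linarith
  obtain ⟨D1, hD1, hK1⟩ := KK_large hβ1 hβ hp0 hp1.le
  obtain ⟨D2, hD2, hK2⟩ := KK_large hβ1 hβ one_pos le_rfl
  refine ⟨max D1 D2, lt_max_of_lt_left hD1, ?_⟩
  rintro D hD lam ⟨hl0, hl1⟩
  have hKp := hK1 D (le_trans (le_max_left _ _) hD)
  have hKo := hK2 D (le_trans (le_max_right _ _) hD)
  have hD0 : 0 < D := lt_of_lt_of_le (lt_max_of_lt_left hD1) hD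
  have hconc := KK_concave hβh hβ1 hD0
  -- positivity of b to the right
  have hbr : ∀ z, 1 / β ≤ z → lam1 + 1 ≤ b z β C D := by
    intro z hz
    have h2 := j12_right hβ hβ1 hz
    have h3 := j_le' hβ (z := z) (by linarith)
    unfold b
    have : 0 < C * D * (j1 z β - j2 z) := mul_pos (by positivity) (by linarith)
    nlinarith
  have hbpos : ∀ z, KK β D z < 0 → 0 < b z β C D := by
    intro z hz
    rw [b_eq, ← mul_neg]
    exact mul_pos (by positivity) (by linarith)
  have hbneg : ∀ z, 0 < KK β D z → b z β C D < 0 := by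
    intro z hz
    rw [b_eq, neg_lt_zero]
    positivity
  have hKr : KK β D (1 / β) < 0 := by
    by_contra hc
    push Not at hc
    have h2 := hbr (1 / β) le_rfl
    rw [b_eq] at h2
    have : 0 ≤ C / 2 * Real.exp (-(β * (1 / β))) * KK β D (1 / β) := by positivity
    linarith
  have hKl : KK β D 0 < 0 := by simp [KK]
  obtain ⟨t1, ⟨ht10, ht1p⟩, hKt1⟩ := intermediate_value_Ioo hp0.le
    (KK_cont β D).continuousOn ⟨hKl, hKp⟩
  obtain ⟨t2, ⟨ht20, ht2p⟩, hKt2⟩ := intermediate_value_Ioo' hib1.le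
    (KK_cont β D).continuousOn ⟨hKr, hKo⟩
  have hjp := j_le hβ hβ1 hp0
  obtain ⟨z1, ⟨hz1p, hz11⟩, hjz1⟩ := intermediate_value_Ioo hp1.le
    (j_cont β).continuousOn (show lam ∈ Set.Ioo (j p β) (j 1 β) from
      ⟨by linarith, by linarith [hmid 1 le_rfl hib1.le]⟩)
  obtain ⟨M, hMl, hM⟩ := (((j_tendsto hβ).eventually_lt_const (h0.trans hl0)).and
    (eventually_gt_atTop (1 / β))).exists
  obtain ⟨z2, ⟨hz2l, hz2M⟩, hjz2⟩ := intermediate_value_Ioo' hM.le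
    (j_cont β).continuousOn (show lam ∈ Set.Ioo (j M β) (j (1 / β) β) from
      ⟨hMl, by linarith [hmid (1 / β) hib1.le le_rfl]⟩)
  simp only at hjz1 hjz2
  have hright : ∀ z, t2 < z → 0 < b z β C D := by
    intro z hz
    rcases le_or_gt z (1 / β) with h | h
    · exact hbpos z (conc_neg_right hconc ht10.le hKt1 hKt2 (by linarith) (by linarith) hz)
    · linarith [hbr z h.le]
  refine ⟨z1, z2, t1, t2, ht10, by linarith, by linarith, by linarith, by unfold a; linarith,
    by unfold a; linarith, ?_, by rw [b_eq, hKt1]; simp, by rw [b_eq, hKt2]; simp, ?_, ?_, ?_⟩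
  · intro z hz ha
    have ha : j z β = lam := by unfold a at ha; linarith
    rcases le_or_gt z 1 with h | h
    · left
      rcases lt_trichotomy z z1 with h' | h' | h'
      · have := j_mono hβ hβ1 hz.le h' hz11.le; linarith
      · exact h'
      · have := j_mono hβ hβ1 (by linarith) h' h; linarith
    · right
      rcases le_or_gt z (1 / β) with g | g
      · have := hmid z h.le g; linarith
      rcases lt_trichotomy z z2 with h' | h' | h'
      · have := j_anti hβ hβ1 g.le h'; linarith
      · exact h'
      · have := j_anti hβ hβ1 hz2l.le h'; linarith
  · intro z hz hb
    rcases lt_trichotomy z t1 with h | h | h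
    · have := hbpos z (conc_neg_left hconc (by linarith) hKt1 hKt2 hz.le h (by linarith))
      linarith
    · exact Or.inl h
    rcases lt_trichotomy z t2 with g | g | g
    · have := hbneg z (conc_pos hconc ht10.le (by linarith) hKt1 hKt2 h g)
      linarith
    · exact Or.inr g
    · have := hright z g
      linarith
  · intro z hz hzz
    unfold r
    rcases le_or_gt z p with h | h
    · have h2 := j12_left hβ hβ1 hz (by linarith)
      have h3 := j_le hβ hβ1 hz
      have h4 := j_nonneg hβ hz.le
      have hbC : b z β C D ≤ C := by
        unfold b
        have : 0 < C * D * (j2 z - j1 z β) := mul_pos (by positivity) (by linarith)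
        have h5 := mul_nonneg hC0.le h4
        linarith
      have : z * b z β C D ≤ z * C := mul_le_mul_of_nonneg_left hbC hz.le
      have h6 : z * (1 + C) ≤ p * (1 + C) := mul_le_mul_of_nonneg_right h (by linarith)
      unfold a
      linarith
    · have h2 := hbneg z (conc_pos hconc ht10.le (by linarith) hKt1 hKt2 (by linarith) (by linarith))
      have h3 := j_mono hβ hβ1 hz.le hzz hz11.le
      have h4 := mul_neg_of_pos_of_neg hz h2
      unfold a
      linarith
  · intro z hz
    unfold r
    rcases le_or_gt z (1 / β) with h | h
    · have h2 := hright z hz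
      have h3 := hmid z (by linarith) h
      have h4 : 0 < z * b z β C D := mul_pos (by linarith) h2
      unfold a
      linarith
    · have h2 := hbr z h.le
      have h3 := j_nonneg hβ (z := z) (by linarith)
      have h4 : 1 * (lam1 + 1) ≤ z * b z β C D :=
        mul_le_mul (by linarith) h2 (by linarith) (by linarith)
      unfold a
      linarith
end
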